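/- Let λ be a partition with Frobenius coordinates (p₁,…,p_d | q₁,…,q_d). Then dim λ / |λ|! = det[ 1 / (p_i! q_j! (p_i + q_j + 1)) ]_{i,j=1}^d. -/

import Mathlib

/-- The number of standard Young tableaux of shape `μ`: bijective fillings of
the cells by `0, …, |μ|-1` which increase along rows and columns. -/
noncomputable def sytCard (μ : YoungDiagram) : ℕ :=
  Nat.card {f : μ.cells → Fin μ.card //
    Function.Bijective f ∧
      ∀ c d : μ.cells, (c : ℕ × ℕ).1 ≤ (d : ℕ × ℕ).1 →
        (c : ℕ × ℕ).2 ≤ (d : ℕ × ℕ).2 → c ≠ d → f c < f d}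

namespace FrobHook

open Finset

/-- fillings as total functions, zero outside the diagram -/
def T (μ : YoungDiagram) (n : ℕ) : Set (ℕ × ℕ → ℕ) :=
  {f | (∀ x, x ∉ μ → f x = 0) ∧ (∀ x ∈ μ, f x < n) ∧
    (∀ x ∈ μ, ∀ y ∈ μ, f x = f y → x = y) ∧ (∀ k < n, ∃ x ∈ μ, f x = k) ∧
    ∀ x ∈ μ, ∀ y ∈ μ, x.1 ≤ y.1 → x.2 ≤ y.2 → x ≠ y → f x < f y}

theorem T_equiv (μ : YoungDiagram) : Nonempty ({f : μ.cells → Fin μ.card //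
    Function.Bijective f ∧
      ∀ c d : μ.cells, (c : ℕ × ℕ).1 ≤ (d : ℕ × ℕ).1 →
        (c : ℕ × ℕ).2 ≤ (d : ℕ × ℕ).2 → c ≠ d → f c < f d} ≃ T μ μ.card) := by
  classical
  refine ⟨⟨fun f => ⟨fun x => if h : x ∈ μ.cells then (f.1 ⟨x, h⟩ : ℕ) else 0, ?_⟩,
    fun g => ⟨fun x => ⟨g.1 x, g.2.2.1 x (by simpa using x.2)⟩, ?_⟩, ?_, ?_⟩⟩
  · obtain ⟨f, ⟨hi, hs⟩, hm⟩ := f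
    refine ⟨?_, ?_, ?_, ?_, ?_⟩
    · intro x hx
      have : x ∉ μ.cells := by simpa using hx
      simp [hx]
    · intro x hx
      simp [hx]
    · intro x hx y hy h
      simp only [YoungDiagram.mem_cells, hx, hy, dite_true] at h
      have := hi (Fin.ext h)
      simpa using this
    · intro k hk
      obtain ⟨x, hx⟩ := hs ⟨k, hk⟩
      have hx2 : (x : ℕ × ℕ) ∈ μ := by simpa using x.2
      refine ⟨x, hx2, ?_⟩
      simp [hx2, hx]
    · intro x hx y hy h1 h2 h3
      simp only [YoungDiagram.mem_cells, hx, hy, dite_true]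
      exact hm ⟨x, by simpa using hx⟩ ⟨y, by simpa using hy⟩ h1 h2 (by simpa using h3)
  · obtain ⟨g, h0, hlt, hi, hs, hm⟩ := g
    refine ⟨⟨?_, ?_⟩, ?_⟩
    · intro x y h
      have h' : g x = g y := by simpa using h
      exact Subtype.ext (hi x (by simpa using x.2) y (by simpa using y.2) h')
    · intro k
      obtain ⟨x, hx, h⟩ := hs k k.2
      exact ⟨⟨x, by simpa using hx⟩, Fin.ext h⟩
    · intro c d h1 h2 h3
      exact hm c (by simpa using c.2) d (by simpa using d.2) h1 h2 (fun h => h3 (Subtype.ext h))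
  · intro f
    ext x
    have hx2 : (x : ℕ × ℕ) ∈ μ := by simpa using x.2
    simp [hx2]
  · intro g
    ext x
    by_cases hx : x ∈ μ
    · simp [hx]
    · simp [hx, g.2.1 x hx]

theorem T_ncard (μ : YoungDiagram) : sytCard μ = (T μ μ.card).ncard := by
  obtain ⟨e⟩ := T_equiv μ
  exact Nat.card_congr e

theorem T_finite (μ : YoungDiagram) : (T μ μ.card).Finite := by
  obtain ⟨e⟩ := T_equiv μ
  exact Set.finite_coe_iff.mp (Finite.of_equiv _ e)

/-- remove everything weakly south-east of `c` -/
def er (μ : YoungDiagram) (c : ℕ × ℕ) : YoungDiagram where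
  cells := μ.cells.filter (fun x => ¬ c ≤ x)
  isLowerSet := by
    intro a b hab ha
    simp only [coe_filter, YoungDiagram.mem_cells, Set.mem_ofPred_eq] at ha ⊢
    exact ⟨μ.up_left_mem hab.1 hab.2 ha.1, fun h => ha.2 (h.trans hab)⟩

def IsCorner (μ : YoungDiagram) (c : ℕ × ℕ) : Prop :=
  c ∈ μ ∧ (c.1 + 1, c.2) ∉ μ ∧ (c.1, c.2 + 1) ∉ μ

theorem mem_er {μ : YoungDiagram} {c : ℕ × ℕ} (hc : IsCorner μ c) (x : ℕ × ℕ) :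
    x ∈ er μ c ↔ x ∈ μ ∧ x ≠ c := by
  have : x ∈ er μ c ↔ x ∈ μ ∧ ¬ c ≤ x := by
    rw [← YoungDiagram.mem_cells]; simp [er]
  rw [this]
  refine and_congr_right fun hx => not_congr ⟨fun h => ?_, fun h => h.ge⟩
  obtain ⟨a, b⟩ := c
  obtain ⟨u, v⟩ := x
  obtain ⟨h1, h2, h3⟩ := hc
  simp only [Prod.mk_le_mk] at h
  by_cases e1 : u = a
  · by_cases e2 : v = b
    · rw [e1, e2]
    · exact absurd (μ.up_left_mem h.1 (by simp; omega) hx) h3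
  · exact absurd (μ.up_left_mem (by simp; omega) h.2 hx) h2

theorem card_er {μ : YoungDiagram} {c : ℕ × ℕ} (hc : IsCorner μ c) :
    (er μ c).card + 1 = μ.card := by
  classical
  have : (er μ c).cells = μ.cells.erase c := by
    ext x
    rw [YoungDiagram.mem_cells, mem_er hc]
    simp [and_comm]
  have h2 : c ∈ μ.cells := by simpa using hc.1
  unfold YoungDiagram.card
  rw [this, Finset.card_erase_add_one h2]

open Classical in
noncomputable def corners (μ : YoungDiagram) : Finset (ℕ × ℕ) := μ.cells.filter (IsCorner μ)

theorem mem_corners {μ : YoungDiagram} {c : ℕ × ℕ} : c ∈ corners μ ↔ IsCorner μ c := by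
  simp only [corners, mem_filter, YoungDiagram.mem_cells, and_iff_right_iff_imp]
  exact fun h => h.1

theorem T_corner {μ : YoungDiagram} {n : ℕ} {c : ℕ × ℕ} (hc : IsCorner μ c) :
    {f ∈ T μ (n+1) | f c = n} = (fun f => Function.update f c n) '' T (er μ c) n := by
  ext f
  constructor
  · rintro ⟨⟨h0, hlt, hi, hs, hm⟩, hn⟩
    refine ⟨Function.update f c 0, ⟨?_, ?_, ?_, ?_, ?_⟩, ?_⟩
    · intro x hx
      rw [mem_er hc] at hx
      by_cases e : x = c
      · simp [e]
      · rw [Function.update_of_ne e]; exact h0 x (fun h => hx ⟨h, e⟩)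
    · intro x hx
      rw [mem_er hc] at hx
      rw [Function.update_of_ne hx.2]
      have := hlt x hx.1
      have : f x ≠ n := fun h => hx.2 (hi x hx.1 c hc.1 (h.trans hn.symm))
      omega
    · intro x hx y hy
      rw [mem_er hc] at hx hy
      rw [Function.update_of_ne hx.2, Function.update_of_ne hy.2]
      exact hi x hx.1 y hy.1
    · intro k hk
      obtain ⟨x, hx, h⟩ := hs k (by omega)
      have e : x ≠ c := by rintro rfl; omega
      exact ⟨x, (mem_er hc x).2 ⟨hx, e⟩, by rw [Function.update_of_ne e, h]⟩
    · intro x hx y hy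
      rw [mem_er hc] at hx hy
      rw [Function.update_of_ne hx.2, Function.update_of_ne hy.2]
      exact hm x hx.1 y hy.1
    · simp [← hn]
  · rintro ⟨g, ⟨h0, hlt, hi, hs, hm⟩, rfl⟩
    have key : ∀ x ∈ μ, x ≠ c → x ∈ er μ c := fun x hx e => (mem_er hc x).2 ⟨hx, e⟩
    refine ⟨⟨?_, ?_, ?_, ?_, ?_⟩, by simp⟩
    · intro x hx
      have e : x ≠ c := by rintro rfl; exact hx hc.1
      simp only [Function.update_of_ne e]
      exact h0 x (fun h => hx ((mem_er hc x).1 h).1)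
    · intro x hx
      by_cases e : x = c
      · simp [e]
      · simp only [Function.update_of_ne e]
        have := hlt x (key x hx e)
        omega
    · intro x hx y hy
      by_cases e : x = c <;> by_cases e' : y = c
      · simp [e, e']
      · subst e
        simp only [Function.update_of_ne e', Function.update_self]
        have := hlt y (key y hy e')
        omega
      · subst e'
        simp only [Function.update_of_ne e, Function.update_self]
        have := hlt x (key x hx e)
        omega
      · simp only [Function.update_of_ne e, Function.update_of_ne e']
        exact hi x (key x hx e) y (key y hy e')
    · intro k hk
      by_cases e : k = n
      · exact ⟨c, hc.1, by simp [e]⟩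
      · obtain ⟨x, hx, h⟩ := hs k (by omega)
        rw [mem_er hc] at hx
        exact ⟨x, hx.1, by simp only [Function.update_of_ne hx.2, h]⟩
    · intro x hx y hy h1 h2 h3
      by_cases e : x = c
      · subst e
        exfalso
        have e' : y ≠ x := h3.symm
        have h4 := (mem_er hc y).2 ⟨hy, e'⟩
        have h5 := (er μ x).up_left_mem h1 h2 h4
        exact ((mem_er hc x).1 h5).2 rfl
      · by_cases e' : y = c
        · subst e'
          simp only [Function.update_of_ne e, Function.update_self]
          exact hlt x (key x hx e)
        · simp only [Function.update_of_ne e, Function.update_of_ne e']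
          exact hm x (key x hx e) y (key y hy e') h1 h2 h3

theorem T_rec {μ : YoungDiagram} {n : ℕ} (hn : μ.card = n + 1) :
    (T μ (n+1)).ncard = ∑ c ∈ corners μ, (T (er μ c) n).ncard := by
  have hU : T μ (n+1) = ⋃ c ∈ corners μ, {f ∈ T μ (n+1) | f c = n} := by
    ext f
    simp only [Set.mem_iUnion, Set.mem_ofPred_eq, exists_prop]
    constructor
    · intro hf
      obtain ⟨h0, hlt, hi, hs, hm⟩ := id hf
      obtain ⟨c, hc, h⟩ := hs n (by omega)
      refine ⟨c, mem_corners.2 ⟨hc, fun h1 => ?_, fun h1 => ?_⟩, hf, h⟩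
      · have := hm c hc _ h1 (by simp) (by simp) (by intro e; simpa using congrArg Prod.fst e)
        have := hlt _ h1
        omega
      · have := hm c hc _ h1 (by simp) (by simp) (by intro e; simpa using congrArg Prod.snd e)
        have := hlt _ h1
        omega
    · rintro ⟨c, _, h, _⟩; exact h
  have hfin : (T μ (n+1)).Finite := hn ▸ T_finite μ
  have h1 : (T μ (n+1)).ncard = ∑ c ∈ corners μ, ({f ∈ T μ (n+1) | f c = n}).ncard := by
    conv_lhs => rw [hU]
    rw [Set.ncard_eq_toFinset_card _ (hU ▸ hfin)]
    classical
    have : ∀ c, ({f ∈ T μ (n+1) | f c = n}).Finite := fun c => hfin.subset (Set.sep_subset _ _)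
    have h2 : (hU ▸ hfin : (⋃ c ∈ corners μ, {f ∈ T μ (n+1) | f c = n}).Finite).toFinset
        = (corners μ).biUnion (fun c => (this c).toFinset) := by
      ext f
      simp only [Set.Finite.mem_toFinset, Set.mem_iUnion, mem_biUnion, exists_prop]
    rw [h2, Finset.card_biUnion]
    · refine Finset.sum_congr rfl fun c _ => ?_
      rw [Set.ncard_eq_toFinset_card _ (this c)]
    · intro c hc c' hc' hne
      simp only [Function.onFun]
      rw [Finset.disjoint_left]
      intro f hf hf'
      simp only [Set.Finite.mem_toFinset, Set.mem_ofPred_eq] at hf hf'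
      exact hne (hf.1.2.2.1 c (mem_corners.1 hc).1 c' (mem_corners.1 hc').1 (hf.2.trans hf'.2.symm))
  rw [h1]
  refine Finset.sum_congr rfl fun c hc => ?_
  have hc := mem_corners.1 hc
  rw [T_corner hc]
  apply Set.InjOn.ncard_image
  intro f hf g hg h
  ext x
  by_cases e : x = c
  · subst e
    have hx : x ∉ er μ x := fun h => ((mem_er hc x).1 h).2 rfl
    rw [hf.1 x hx, hg.1 x hx]
  · have := congrFun h x
    simpa [Function.update_of_ne e] using this

/-! ### algebra -/

def g (p q : ℕ) : ℚ := 1 / ((Nat.factorial p) * (Nat.factorial q) * (p + q + 1))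
def g' (p q : ℕ) : ℚ := p / ((Nat.factorial p) * (Nat.factorial q) * (p + q))

theorem g_symm (p q : ℕ) : g p q = g q p := by
  unfold g; congr 1; ring

theorem g'_zero (q : ℕ) : g' 0 q = 0 := by simp [g']

theorem g'_succ (p q : ℕ) : g' (p+1) q = g p q := by
  unfold g g'
  rw [Nat.factorial_succ]
  have h1 : (Nat.factorial p : ℚ) ≠ 0 := by positivity
  have h2 : (Nat.factorial q : ℚ) ≠ 0 := by positivity
  have h3 : (p : ℚ) + q + 1 ≠ 0 := by positivity
  have h4 : (p : ℚ) + 1 + q ≠ 0 := by positivity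
  have h5 : (p : ℚ) + 1 ≠ 0 := by positivity
  push_cast
  rw [div_eq_div_iff (by positivity) (by positivity)]
  ring

theorem g_rec (p q : ℕ) :
    ((p : ℚ) + q + 1) * g p q = g' p q + g' q p + if p = 0 ∧ q = 0 then 1 else 0 := by
  unfold g g'
  have h1 : (Nat.factorial p : ℚ) ≠ 0 := by positivity
  have h2 : (Nat.factorial q : ℚ) ≠ 0 := by positivity
  have h3 : (p : ℚ) + q + 1 ≠ 0 := by positivity
  split_ifs with h
  · obtain ⟨rfl, rfl⟩ := h; simp
  · have h4 : (p : ℚ) + q ≠ 0 := by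
      have : 0 < p + q := by omega
      have : (0 : ℚ) < (p + q : ℕ) := by exact_mod_cast this
      push_cast at this; exact this.ne'
    have h5 : (q : ℚ) + p ≠ 0 := by rwa [add_comm]
    field_simp
    ring

theorem sum_updateRow {d : ℕ} (M R : Matrix (Fin d) (Fin d) ℚ) :
    ∑ i, (M.updateRow i (R i)).det = ∑ i, ∑ j, R i j * M.adjugate j i := by
  refine Finset.sum_congr rfl fun i _ => ?_
  rw [Matrix.det_eq_sum_mul_adjugate_row _ i]
  refine Finset.sum_congr rfl fun j _ => ?_
  rw [Matrix.adjugate_apply, Matrix.adjugate_apply]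
  simp

theorem sum_updateRow_transpose {d : ℕ} (M R : Matrix (Fin d) (Fin d) ℚ) :
    ∑ j, (M.transpose.updateRow j (fun i => R i j)).det = ∑ i, ∑ j, R i j * M.adjugate j i := by
  rw [sum_updateRow M.transpose (fun j i => R i j), Finset.sum_comm]
  simp [← Matrix.adjugate_transpose]

theorem det_rec {d : ℕ} (p q : Fin d → ℕ) :
    ((∑ i, (p i : ℚ)) + (∑ i, (q i : ℚ)) + d) * (Matrix.of fun i j => g (p i) (q j)).det =
      (∑ i, ((Matrix.of fun i j => g (p i) (q j)).updateRow i (fun j => g' (p i) (q j))).det) +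
      (∑ j, ((Matrix.of fun j i => g (q j) (p i)).updateRow j (fun i => g' (q j) (p i))).det) +
      ∑ i, ∑ j, (if p i = 0 ∧ q j = 0 then (1:ℚ) else 0) *
        (Matrix.of fun i j => g (p i) (q j)).adjugate j i := by
  set M : Matrix (Fin d) (Fin d) ℚ := Matrix.of fun i j => g (p i) (q j) with hM
  have hT : (Matrix.of fun j i => g (q j) (p i)) = M.transpose := by
    ext i j; simp [hM, g_symm]
  rw [hT, sum_updateRow M (fun i j => g' (p i) (q j)),
    sum_updateRow_transpose M (fun i j => g' (q j) (p i))]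
  simp only [← Finset.sum_add_distrib, ← add_mul, ← g_rec]
  have e : ∀ i j, ((p i : ℚ) + q j + 1) * g (p i) (q j) * M.adjugate j i =
      p i * (M i j * M.adjugate j i) + q j * (M i j * M.adjugate j i)
       + M i j * M.adjugate j i := by
    intro i j; simp only [hM, Matrix.of_apply]; ring
  simp only [e, Finset.sum_add_distrib]
  have hr : ∀ i, ∑ j, M i j * M.adjugate j i = M.det := fun i =>
    (Matrix.det_eq_sum_mul_adjugate_row M i).symm
  have hcl : ∀ j, ∑ i, M i j * M.adjugate j i = M.det := fun j =>
    (Matrix.det_eq_sum_mul_adjugate_col M j).symm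
  rw [Finset.sum_comm (f := fun i j => (q j : ℚ) * (M i j * M.adjugate j i))]
  simp only [← Finset.mul_sum, hr, hcl, Finset.sum_const, Finset.card_univ, Fintype.card_fin]
  simp only [← Finset.sum_mul, nsmul_eq_mul]
  ring

/-! ### diagram side -/

def diag (μ : YoungDiagram) : ℕ := (μ.cells.filter (fun c => c.1 = c.2)).card

def Good (μ : YoungDiagram) (d : ℕ) : Prop := ∀ i : ℕ, (i, i) ∈ μ ↔ i < d

theorem diag_filter {μ : YoungDiagram} {d : ℕ} (h : Good μ d) :
    μ.cells.filter (fun c => c.1 = c.2) = (range d).map ⟨fun i => (i,i), fun a b h => by simpa using h⟩ := by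
  ext ⟨a, b⟩
  simp only [mem_filter, YoungDiagram.mem_cells, mem_map, mem_range, Function.Embedding.coeFn_mk]
  constructor
  · rintro ⟨h1, rfl⟩; exact ⟨a, (h a).1 h1, rfl⟩
  · rintro ⟨i, hi, e⟩
    obtain ⟨rfl, rfl⟩ := Prod.mk.inj e
    exact ⟨(h i).2 hi, rfl⟩

theorem diag_eq {μ : YoungDiagram} {d : ℕ} (h : Good μ d) : diag μ = d := by
  unfold diag; rw [diag_filter h]; simp

theorem exists_good (μ : YoungDiagram) : ∃ d, Good μ d := by
  classical
  have hex : ∃ i, (i, i) ∉ μ := by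
    obtain ⟨j, hj⟩ := μ.exists_notMem_row 0
    exact ⟨j, fun h => hj (μ.up_left_mem (by simp) le_rfl h)⟩
  refine ⟨Nat.find hex, fun i => ⟨fun h => ?_, fun h => ?_⟩⟩
  · by_contra hi
    exact Nat.find_spec hex (μ.up_left_mem (by omega) (by omega) h)
  · by_contra hi
    exact Nat.find_min hex h hi

theorem good_diag (μ : YoungDiagram) : Good μ (diag μ) := by
  obtain ⟨d, hd⟩ := exists_good μ
  rw [diag_eq hd]; exact hd

def P (μ : YoungDiagram) (i : ℕ) : ℕ := μ.rowLen i - i - 1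
def Q (μ : YoungDiagram) (j : ℕ) : ℕ := μ.colLen j - j - 1

def Mat (μ : YoungDiagram) (d : ℕ) : Matrix (Fin d) (Fin d) ℚ :=
  Matrix.of fun i j => g (P μ i) (Q μ j)

noncomputable def H (μ : YoungDiagram) : ℚ := (Mat μ (diag μ)).det

theorem H_eq {μ : YoungDiagram} {d : ℕ} (h : Good μ d) : H μ = (Mat μ d).det := by
  have := diag_eq h
  subst this; rfl

theorem good_transpose {μ : YoungDiagram} {d : ℕ} (h : Good μ d) : Good μ.transpose d := by
  intro i; rw [YoungDiagram.mem_transpose]; exact h i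

theorem P_transpose (μ : YoungDiagram) (i : ℕ) : P μ.transpose i = Q μ i := by simp [P, Q]
theorem Q_transpose (μ : YoungDiagram) (i : ℕ) : Q μ.transpose i = P μ i := by simp [P, Q]

theorem H_transpose (μ : YoungDiagram) : H μ.transpose = H μ := by
  rw [H_eq (good_transpose (good_diag μ)), H_eq (good_diag μ), ← Matrix.det_transpose]
  congr 1
  ext i j
  simp [Mat, P_transpose, Q_transpose, g_symm]

theorem card_upper {μ : YoungDiagram} {d : ℕ} (h : Good μ d) :
    (μ.cells.filter (fun c => c.1 < c.2)).card = ∑ i : Fin d, P μ i := by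
  rw [← Finset.sum_range (fun i => P μ i)]
  rw [Finset.card_eq_sum_card_fiberwise (f := Prod.fst) (t := range d)]
  · refine Finset.sum_congr rfl fun i _ => ?_
    have : (μ.cells.filter (fun c => c.1 < c.2)).filter (fun c => c.1 = i)
        = (Ico (i+1) (μ.rowLen i)).map ⟨fun j => (i, j), fun a b h => by simpa using h⟩ := by
      ext ⟨a, b⟩
      simp only [mem_filter, YoungDiagram.mem_cells, mem_map, mem_Ico, Function.Embedding.coeFn_mk,
        Prod.mk.injEq, YoungDiagram.mem_iff_lt_rowLen]
      constructor
      · rintro ⟨⟨h1, h2⟩, rfl⟩; exact ⟨b, ⟨h2, h1⟩, rfl⟩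
      · rintro ⟨j, ⟨h1, h2⟩, e⟩
        obtain ⟨rfl, rfl⟩ := Prod.mk.inj e
        exact ⟨⟨h2, h1⟩, rfl⟩
    rw [this]; simp [P]; omega
  · rintro ⟨a, b⟩ hc
    simp only [coe_filter, YoungDiagram.mem_cells, Set.mem_ofPred_eq] at hc
    simp only [coe_range, Set.mem_Iio]
    exact (h a).1 (μ.up_left_mem le_rfl hc.2.le hc.1)

theorem card_lower {μ : YoungDiagram} {d : ℕ} (h : Good μ d) :
    (μ.cells.filter (fun c => c.2 < c.1)).card = ∑ i : Fin d, Q μ i := by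
  simp only [← P_transpose]
  rw [← card_upper (good_transpose h)]
  refine Finset.card_bij (fun c _ => c.swap) ?_ ?_ ?_
  · rintro ⟨a, b⟩ hc; simpa [YoungDiagram.mem_transpose] using hc
  · rintro a _ b _ h; exact Prod.swap_injective h
  · rintro ⟨a, b⟩ hc
    refine ⟨(b, a), ?_, rfl⟩
    simpa [YoungDiagram.mem_transpose] using hc

theorem card_eq {μ : YoungDiagram} {d : ℕ} (h : Good μ d) :
    μ.card = (∑ i : Fin d, P μ i) + (∑ i : Fin d, Q μ i) + d := by
  rw [← card_upper h, ← card_lower h]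
  conv_rhs => rw [← diag_eq h]
  unfold diag YoungDiagram.card
  rw [← Finset.card_filter_add_card_filter_not (s := μ.cells) (fun c => c.1 < c.2), add_assoc]
  congr 1
  rw [← Finset.card_filter_add_card_filter_not
    (s := μ.cells.filter (fun c => ¬ c.1 < c.2)) (fun c => c.2 < c.1)]
  rw [Finset.filter_filter, Finset.filter_filter]
  congr 2 <;> ext x <;> simp only [mem_filter] <;> constructor <;> rintro ⟨h1, h2⟩ <;>
    refine ⟨h1, ?_⟩ <;> omega

theorem rowLen_eq {μ : YoungDiagram} {i k : ℕ} (h : ∀ j, (i, j) ∈ μ ↔ j < k) : μ.rowLen i = k := by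
  have h1 : ∀ j, j < μ.rowLen i ↔ j < k := fun j => by rw [← YoungDiagram.mem_iff_lt_rowLen, h]
  have := h1 k
  have := h1 (μ.rowLen i)
  omega

theorem colLen_eq {μ : YoungDiagram} {j k : ℕ} (h : ∀ i, (i, j) ∈ μ ↔ i < k) : μ.colLen j = k := by
  have h1 : ∀ i, i < μ.colLen j ↔ i < k := fun i => by rw [← YoungDiagram.mem_iff_lt_colLen, h]
  have := h1 k
  have := h1 (μ.colLen j)
  omega

theorem rowLen_er_ne {μ : YoungDiagram} {c : ℕ × ℕ} (hc : IsCorner μ c) {i : ℕ} (hi : i ≠ c.1) :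
    (er μ c).rowLen i = μ.rowLen i := by
  apply rowLen_eq
  intro j
  rw [mem_er hc, YoungDiagram.mem_iff_lt_rowLen]
  refine and_iff_left fun h => hi ?_
  rw [← h]

theorem colLen_er_ne {μ : YoungDiagram} {c : ℕ × ℕ} (hc : IsCorner μ c) {j : ℕ} (hj : j ≠ c.2) :
    (er μ c).colLen j = μ.colLen j := by
  apply colLen_eq
  intro i
  rw [mem_er hc, YoungDiagram.mem_iff_lt_colLen]
  refine and_iff_left fun h => hj ?_
  rw [← h]

theorem corner_rowLen {μ : YoungDiagram} {c : ℕ × ℕ} (hc : IsCorner μ c) :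
    μ.rowLen c.1 = c.2 + 1 := by
  obtain ⟨h1, h2, h3⟩ := hc
  have h1' : (c.1, c.2) ∈ μ := h1
  rw [YoungDiagram.mem_iff_lt_rowLen] at h1' h3
  omega

theorem corner_colLen {μ : YoungDiagram} {c : ℕ × ℕ} (hc : IsCorner μ c) :
    μ.colLen c.2 = c.1 + 1 := by
  obtain ⟨h1, h2, h3⟩ := hc
  have h1' : (c.1, c.2) ∈ μ := h1
  rw [YoungDiagram.mem_iff_lt_colLen] at h1' h2
  omega

theorem rowLen_er {μ : YoungDiagram} {c : ℕ × ℕ} (hc : IsCorner μ c) :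
    (er μ c).rowLen c.1 = c.2 := by
  apply rowLen_eq
  intro j
  rw [mem_er hc, YoungDiagram.mem_iff_lt_rowLen, corner_rowLen hc]
  constructor
  · rintro ⟨h1, h2⟩
    have : j ≠ c.2 := fun h => h2 (by rw [h])
    omega
  · intro h
    refine ⟨by omega, fun h2 => ?_⟩
    have := congrArg Prod.snd h2
    simp at this; omega

/-- determinant with the `i`-th row coordinate decreased -/
noncomputable def rowTerm (μ : YoungDiagram) (d : ℕ) (i : ℕ) : ℚ :=
  (Matrix.of fun a b : Fin d => if (a : ℕ) = i then g' (P μ a) (Q μ b) else g (P μ a) (Q μ b)).det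

theorem rowTerm_eq (μ : YoungDiagram) (d : ℕ) (i : Fin d) :
    ((Matrix.of fun i j : Fin d => g (P μ i) (Q μ j)).updateRow i
      (fun j => g' (P μ i) (Q μ j))).det = rowTerm μ d i := by
  unfold rowTerm
  congr 1
  ext a b
  by_cases h : a = i
  · subst h; simp
  · have : (a : ℕ) ≠ i := fun e => h (Fin.ext e)
    simp [Matrix.updateRow_ne h, this]

theorem upper_corner {μ : YoungDiagram} {d : ℕ} (h : Good μ d) {c : ℕ × ℕ} (hc : IsCorner μ c)
    (hlt : c.1 < c.2) : H (er μ c) = rowTerm μ d c.1 := by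
  have hg : Good (er μ c) d := by
    intro i
    rw [mem_er hc, h i]
    refine and_iff_left_of_imp fun _ e => ?_
    have h1 := congrArg Prod.fst e
    have h2 := congrArg Prod.snd e
    simp at h1 h2; omega
  have hj : d ≤ c.2 := by
    by_contra hj
    exact hc.2.1 (μ.up_left_mem hlt le_rfl ((h c.2).2 (by omega)))
  rw [H_eq hg]
  unfold Mat rowTerm
  congr 1
  ext a b
  simp only [Matrix.of_apply]
  have hQ : Q (er μ c) b = Q μ b := by
    unfold Q; rw [colLen_er_ne hc (by have := b.2; omega)]
  rw [hQ]
  split_ifs with e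
  · have : P μ a = P (er μ c) a + 1 := by
      unfold P
      rw [e, rowLen_er hc, corner_rowLen hc]; omega
    rw [this, g'_succ]
  · unfold P; rw [rowLen_er_ne hc e]

theorem rowTerm_zero {μ : YoungDiagram} {d : ℕ} (h : Good μ d) {i : ℕ} (hi : i < d)
    (hn : ¬ (IsCorner μ (i, μ.rowLen i - 1) ∧ i < μ.rowLen i - 1)) : rowTerm μ d i = 0 := by
  have hii := (h i).2 hi
  rw [YoungDiagram.mem_iff_lt_rowLen] at hii
  by_cases hp : P μ i = 0
  · apply Matrix.det_eq_zero_of_row_eq_zero (⟨i, hi⟩ : Fin d)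
    intro j
    simp [hp, g'_zero]
  · have hp' : i < μ.rowLen i - 1 := by unfold P at hp; omega
    have hm : (i+1, μ.rowLen i - 1) ∈ μ := by
      by_contra hm
      refine hn ⟨⟨?_, hm, ?_⟩, hp'⟩
      · rw [YoungDiagram.mem_iff_lt_rowLen]; omega
      · rw [YoungDiagram.mem_iff_lt_rowLen]; simp only; omega
    have hd : i + 1 < d := (h _).1 (μ.up_left_mem le_rfl (by omega) hm)
    have hr : μ.rowLen (i+1) = μ.rowLen i := by
      apply le_antisymm (μ.rowLen_anti _ _ (by omega))
      rw [YoungDiagram.mem_iff_lt_rowLen] at hm; omega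
    apply Matrix.det_zero_of_row_eq (i := (⟨i, hi⟩ : Fin d)) (j := ⟨i+1, hd⟩)
    · simp
    · ext j
      have : P μ i = P μ (i+1) + 1 := by unfold P at *; omega
      simp [this, g'_succ]

theorem sum_upper {μ : YoungDiagram} {d : ℕ} (h : Good μ d) :
    ∑ c ∈ (corners μ).filter (fun c => c.1 < c.2), H (er μ c) = ∑ i : Fin d, rowTerm μ d i := by
  rw [← Finset.sum_range (fun i => rowTerm μ d i)]
  refine Finset.sum_of_injOn Prod.fst ?_ ?_ ?_ ?_
  · intro c hc c' hc' e
    simp only [coe_filter, Set.mem_ofPred_eq, mem_corners] at hc hc'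
    have h1 := corner_rowLen hc.1
    have h2 := corner_rowLen hc'.1
    rw [e] at h1
    exact Prod.ext e (by omega)
  · intro c hc
    simp only [coe_filter, Set.mem_ofPred_eq, mem_corners] at hc
    simp only [coe_range, Set.mem_Iio]
    exact (h _).1 (μ.up_left_mem le_rfl hc.2.le hc.1.1)
  · intro i hi hn
    apply rowTerm_zero h (by simpa using hi)
    intro hc
    apply hn
    refine ⟨(i, μ.rowLen i - 1), ?_, rfl⟩
    simp only [coe_filter, Set.mem_ofPred_eq, mem_corners]
    exact hc
  · intro c hc
    simp only [mem_filter, mem_corners] at hc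
    exact upper_corner h hc.1 hc.2

theorem corner_transpose {μ : YoungDiagram} {c : ℕ × ℕ} :
    IsCorner μ.transpose c ↔ IsCorner μ c.swap := by
  simp only [IsCorner, YoungDiagram.mem_transpose, Prod.swap, Prod.fst, Prod.snd]
  tauto

theorem er_transpose {μ : YoungDiagram} {c : ℕ × ℕ} (hc : IsCorner μ c) :
    (er μ c).transpose = er μ.transpose c.swap := by
  have hc' : IsCorner μ.transpose c.swap := by rw [corner_transpose]; simpa using hc
  ext x
  rw [YoungDiagram.mem_cells, YoungDiagram.mem_cells, YoungDiagram.mem_transpose, mem_er hc,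
    mem_er hc', YoungDiagram.mem_transpose]
  refine and_congr_right fun _ => not_congr ⟨fun h => ?_, fun h => ?_⟩
  · rw [← h]; simp
  · rw [h]; simp

theorem sum_lower {μ : YoungDiagram} {d : ℕ} (h : Good μ d) :
    ∑ c ∈ (corners μ).filter (fun c => c.2 < c.1), H (er μ c)
      = ∑ i : Fin d, rowTerm μ.transpose d i := by
  rw [← sum_upper (good_transpose h)]
  refine Finset.sum_bij (fun c _ => c.swap) ?_ ?_ ?_ ?_
  · intro c hc
    simp only [mem_filter, mem_corners, corner_transpose] at hc ⊢
    simpa using hc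
  · rintro a _ b _ h; exact Prod.swap_injective h
  · intro c hc
    refine ⟨c.swap, ?_, by simp⟩
    simp only [mem_filter, mem_corners, corner_transpose] at hc ⊢
    simpa using hc
  · intro c hc
    simp only [mem_filter, mem_corners] at hc
    rw [← er_transpose hc.1, H_transpose]

theorem P_pos {μ : YoungDiagram} {d : ℕ} (h : Good μ d) {i : ℕ} (hi : i + 1 < d) : P μ i ≠ 0 := by
  have h1 := μ.up_left_mem (Nat.le_succ i) le_rfl ((h (i+1)).2 hi)
  rw [YoungDiagram.mem_iff_lt_rowLen] at h1
  unfold P; omega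

theorem Q_pos {μ : YoungDiagram} {d : ℕ} (h : Good μ d) {i : ℕ} (hi : i + 1 < d) : Q μ i ≠ 0 := by
  rw [← P_transpose]; exact P_pos (good_transpose h) hi

theorem sum_diag {μ : YoungDiagram} {d : ℕ} (h : Good μ d) :
    ∑ c ∈ (corners μ).filter (fun c => c.1 = c.2), H (er μ c)
      = ∑ i : Fin d, ∑ j : Fin d, (if P μ i = 0 ∧ Q μ j = 0 then (1:ℚ) else 0) *
        (Mat μ d).adjugate j i := by
  have hmem : ∀ c, IsCorner μ c → c.1 = c.2 → c.1 + 1 = d := by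
    rintro ⟨a, b⟩ hc e
    simp only at e
    subst e
    have h1 := (h a).1 hc.1
    have h2 : ¬ a + 1 < d := fun h2 =>
      hc.2.1 (μ.up_left_mem le_rfl (Nat.le_succ a) ((h (a+1)).2 h2))
    simp only; omega
  cases d with
  | zero =>
    rw [Finset.filter_eq_empty_iff.2]
    · simp
    · intro c hc e
      have := hmem c (mem_corners.1 hc) e
      omega
  | succ e =>
    have hR : ∑ i : Fin (e+1), ∑ j : Fin (e+1), (if P μ i = 0 ∧ Q μ j = 0 then (1:ℚ) else 0) *
        (Mat μ (e+1)).adjugate j i = (if P μ e = 0 ∧ Q μ e = 0 then (1:ℚ) else 0) *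
        (Mat μ (e+1)).adjugate (Fin.last e) (Fin.last e) := by
      rw [Finset.sum_eq_single (Fin.last e), Finset.sum_eq_single (Fin.last e)]
      · simp
      · intro j _ hj
        have : (j : ℕ) ≠ e := fun hh => hj (Fin.ext hh)
        have := Q_pos h (i := j) (by have := j.2; omega)
        simp [this]
      · simp
      · intro i _ hi
        have : (i : ℕ) ≠ e := fun hh => hi (Fin.ext hh)
        have := P_pos h (i := i) (by have := i.2; omega)
        simp [this]
      · simp
    rw [hR]
    have hee := (h e).2 (by omega)
    have hee1 := YoungDiagram.mem_iff_lt_rowLen.1 hee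
    have hee2 := YoungDiagram.mem_iff_lt_colLen.1 hee
    have hiff : IsCorner μ (e, e) ↔ P μ e = 0 ∧ Q μ e = 0 := by
      unfold IsCorner P Q
      simp only [hee, true_and]
      rw [YoungDiagram.mem_iff_lt_colLen, YoungDiagram.mem_iff_lt_rowLen]
      omega
    by_cases hc : IsCorner μ (e, e)
    · rw [if_pos (hiff.1 hc), one_mul]
      have hs : (corners μ).filter (fun c => c.1 = c.2) = {(e, e)} := by
        ext c
        simp only [mem_filter, mem_corners, mem_singleton]
        constructor
        · rintro ⟨h1, h2⟩
          have := hmem c h1 h2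
          exact Prod.ext (by simp only; omega) (by simp only; omega)
        · rintro rfl; exact ⟨hc, rfl⟩
      rw [hs, Finset.sum_singleton]
      have hg : Good (er μ (e, e)) e := by
        intro i
        rw [mem_er hc, h i]
        simp only [ne_eq, Prod.mk.injEq, and_self]
        omega
      rw [H_eq hg, Matrix.adjugate_fin_succ_eq_det_submatrix]
      simp only [Fin.val_last, ← two_mul, pow_mul]
      simp only [even_two, Even.neg_pow, one_pow, one_mul]
      congr 1
      ext a b
      have ha : (a : ℕ) ≠ e := a.2.ne
      have hb : (b : ℕ) ≠ e := b.2.ne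
      simp [Mat, P, Q, rowLen_er_ne hc ha, colLen_er_ne hc hb]
    · rw [if_neg (fun hh => hc (hiff.2 hh)), zero_mul]
      apply Finset.sum_eq_zero
      intro c hcc
      exfalso
      simp only [mem_filter, mem_corners] at hcc
      have := hmem c hcc.1 hcc.2
      have h2 : c = (e, e) := Prod.ext (by simp only; omega) (by simp only; omega)
      exact hc (h2 ▸ hcc.1)

theorem H_rec (μ : YoungDiagram) : (μ.card : ℚ) * H μ = ∑ c ∈ corners μ, H (er μ c) := by
  have h := good_diag μ
  set d := diag μ
  have hsplit : ∑ c ∈ corners μ, H (er μ c) =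
      ∑ c ∈ (corners μ).filter (fun c => c.1 < c.2), H (er μ c) +
      ∑ c ∈ (corners μ).filter (fun c => c.2 < c.1), H (er μ c) +
      ∑ c ∈ (corners μ).filter (fun c => c.1 = c.2), H (er μ c) := by
    simp only [Finset.sum_filter, ← Finset.sum_add_distrib]
    refine Finset.sum_congr rfl fun c _ => ?_
    rcases lt_trichotomy c.1 c.2 with h | h | h
    · simp [h, h.not_gt, h.ne]
    · simp [h]
    · simp [h, h.not_gt, h.ne']
  rw [hsplit, sum_upper h, sum_lower h, sum_diag h, H_eq h, card_eq h]
  have := det_rec (fun i : Fin d => P μ i) (fun i : Fin d => Q μ i)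
  simp only [rowTerm_eq] at this
  push_cast
  unfold Mat
  rw [this]
  congr 2
  refine Finset.sum_congr rfl fun i _ => ?_
  rw [← rowTerm_eq]
  simp only [P_transpose, Q_transpose]

theorem main (n : ℕ) : ∀ μ : YoungDiagram, μ.card = n →
    ((T μ n).ncard : ℚ) = (Nat.factorial n) * H μ := by
  induction n with
  | zero =>
    intro μ hμ
    have he : ∀ x, x ∉ μ := by
      intro x hx
      rw [← YoungDiagram.mem_cells] at hx
      have : μ.cells = ∅ := Finset.card_eq_zero.1 hμ
      simp [this] at hx
    have hT : T μ 0 = {fun _ => 0} := by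
      ext f
      simp only [T, he, Set.mem_ofPred_eq, Set.mem_singleton_iff]
      constructor
      · intro h; ext x; exact h.1 x (by simp)
      · rintro rfl; simp
    have hg : Good μ 0 := fun i => by simp [he]
    rw [hT, H_eq hg]
    simp
  | succ n ih =>
    intro μ hμ
    rw [T_rec hμ]
    push_cast
    rw [Finset.sum_congr rfl (fun c hc => ih (er μ c) (by
      have := card_er (mem_corners.1 hc); omega)), ← Finset.mul_sum, ← H_rec, hμ,
      Nat.factorial_succ]
    push_cast
    ring

end FrobHook

theorem frobenius_hook_determinant (μ : YoungDiagram) (d : ℕ)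
    (hd : ∀ i : ℕ, (i, i) ∈ μ ↔ i < d)
    (p q : Fin d → ℕ)
    (hp : ∀ i : Fin d, p i = μ.rowLen i - i - 1)
    (hq : ∀ j : Fin d, q j = μ.colLen j - j - 1) :
    (sytCard μ : ℚ) / (Nat.factorial μ.card) =
      Matrix.det (Matrix.of fun i j : Fin d =>
        (1 : ℚ) / ((Nat.factorial (p i)) * (Nat.factorial (q j)) *
          (p i + q j + 1))) := by
  rw [FrobHook.T_ncard, FrobHook.main _ μ rfl, FrobHook.H_eq hd,
    mul_div_cancel_left₀ _ (by positivity)]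
  congr 1
  ext i j
  simp [FrobHook.Mat, FrobHook.g, FrobHook.P, FrobHook.Q, hp, hq]
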